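/- arXiv:1705.10968 — 9 statements merged into one kernel-verified Lean document; each statement's English description precedes it below -/
import Mathlib

section
/- Fix real numbers τ > 0, β > 0, P ≥ 0, q > 0 and c > 0, and define γ(p) = τ·p·β² / (1 + τ·p·β) for p ≥ 0. Then the function p ↦ c·γ(p)·q / (1 + (β − γ(p))·P) is strictly monotonically increasing on [0, ∞); in particular, for any pmax > 0 its maximum over the interval [0, pmax] is attained exactly at p = pmax. -/
/-- Monotonicity of the ZF-with-dedicated-pilots effective SINR in the uplink
training power: with `γ p = τ·p·β²/(1 + τ·p·β)`, the map
`p ↦ c·γ(p)·q / (1 + (β − γ(p))·P)` is strictly increasing on `[0, ∞)`, and on any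
interval `[0, pmax]` its maximum is attained exactly at `p = pmax`. -/
theorem stmt_0 (τ β P q c : ℝ) (hτ : 0 < τ) (hβ : 0 < β) (hP : 0 ≤ P)
    (hq : 0 < q) (hc : 0 < c) :
    StrictMonoOn
      (fun p : ℝ => c * (τ * p * β ^ 2 / (1 + τ * p * β)) * q /
        (1 + (β - τ * p * β ^ 2 / (1 + τ * p * β)) * P)) (Set.Ici (0 : ℝ)) ∧
    ∀ pmax : ℝ, 0 < pmax → ∀ p ∈ Set.Icc (0 : ℝ) pmax, p ≠ pmax →
      c * (τ * p * β ^ 2 / (1 + τ * p * β)) * q /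
        (1 + (β - τ * p * β ^ 2 / (1 + τ * p * β)) * P) <
      c * (τ * pmax * β ^ 2 / (1 + τ * pmax * β)) * q /
        (1 + (β - τ * pmax * β ^ 2 / (1 + τ * pmax * β)) * P) := by
  have key : ∀ p : ℝ, 0 ≤ p → c * (τ * p * β ^ 2 / (1 + τ * p * β)) * q /
        (1 + (β - τ * p * β ^ 2 / (1 + τ * p * β)) * P) =
        (c * q * τ * β ^ 2) * p / (1 + β * P + τ * β * p) := by
    intro p hp
    have h1 : 0 < 1 + τ * p * β := by positivity
    have h2 : 0 < 1 + β * P + τ * β * p := by positivity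
    have h3 : 1 + (β - τ * p * β ^ 2 / (1 + τ * p * β)) * P =
        (1 + β * P + τ * β * p) / (1 + τ * p * β) := by
      field_simp
      ring
    rw [h3]
    field_simp
  have mono : ∀ a b : ℝ, 0 ≤ a → a < b →
      (c * q * τ * β ^ 2) * a / (1 + β * P + τ * β * a) <
      (c * q * τ * β ^ 2) * b / (1 + β * P + τ * β * b) := by
    intro a b ha hab
    have hb : 0 ≤ b := ha.trans hab.le
    rw [div_lt_div_iff₀ (by positivity) (by positivity)]
    have h : 0 < (c * q * τ * β ^ 2) * (1 + β * P) * (b - a) :=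
      mul_pos (by positivity) (sub_pos.2 hab)
    linarith
  refine ⟨?_, ?_⟩
  · intro a ha b hb hab
    simp only [Set.mem_Ici] at ha hb
    change _ < _
    simp only [key a ha, key b hb]
    exact mono a b ha hab
  · intro m hm p hp hne
    rw [key p hp.1, key m hm.le]
    exact mono p m hp.1 (lt_of_le_of_ne hp.2 hne)
end

section
/- Let ι be a nonempty finite index set, a : ι → ℝ with a i > 0 for all i, and P > 0. Consider the set S = { m ∈ ℝ : there exists p : ι → ℝ with p i ≥ 0 for all i, ∑_i p i = P, and m = min_{i} (a i · p i) }. Then S has a greatest element, equal to Γ = P / (∑_i 1/(a i)); it is attained by the allocation p i = Γ / (a i), and at this maximizer a i · p i = Γ for every i ∈ ι. -/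
open Finset

/-- The generic equal-SINR power allocation lemma: with positive coefficients `a i`
and total power `P > 0`, the set of achievable values of `min_i (a i · p i)` over
nonnegative allocations `p` with `∑ p i = P` has greatest element
`Γ = P / ∑ 1/(a i)`, attained by `p i = Γ / a i`, at which point `a i · p i = Γ`
for every `i`. -/
theorem stmt_1 {ι : Type*} [Fintype ι] [Nonempty ι]
    (a : ι → ℝ) (ha : ∀ i, 0 < a i) (P : ℝ) (hP : 0 < P) :
    let Γ : ℝ := P / ∑ i, 1 / a i
    IsGreatest
      {m : ℝ | ∃ p : ι → ℝ, (∀ i, 0 ≤ p i) ∧ ∑ i, p i = P ∧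
        m = univ.inf' univ_nonempty (fun i => a i * p i)} Γ ∧
    (∀ i, 0 ≤ Γ / a i) ∧ (∑ i, Γ / a i = P) ∧
    univ.inf' univ_nonempty (fun i => a i * (Γ / a i)) = Γ ∧
    ∀ i, a i * (Γ / a i) = Γ := by
  intro Γ
  have hS : 0 < ∑ i, 1 / a i :=
    Finset.sum_pos (fun i _ => one_div_pos.mpr (ha i)) univ_nonempty
  have hΓ : 0 < Γ := div_pos hP hS
  have h1 : ∀ i, 0 ≤ Γ / a i := fun i => (div_pos hΓ (ha i)).le
  have hmul : Γ * ∑ i, 1 / a i = P := div_mul_cancel₀ P hS.ne'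
  have h2 : ∑ i, Γ / a i = P := by
    rw [← hmul, Finset.mul_sum]
    exact Finset.sum_congr rfl (fun i _ => by rw [mul_one_div])
  have h4 : ∀ i, a i * (Γ / a i) = Γ := fun i => mul_div_cancel₀ Γ (ha i).ne'
  have h3 : univ.inf' univ_nonempty (fun i => a i * (Γ / a i)) = Γ := by
    simp only [h4, Finset.inf'_const]
  refine ⟨⟨⟨fun i => Γ / a i, h1, h2, h3.symm⟩, ?_⟩, h1, h2, h3, h4⟩
  rintro m ⟨p, _, hsum, hm⟩
  have hle : ∀ i, m ≤ a i * p i := fun i => by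
    rw [hm]
    exact Finset.inf'_le (fun i => a i * p i) (Finset.mem_univ i)
  refine (le_div_iff₀ hS).mpr ?_
  rw [← hsum, Finset.mul_sum]
  refine Finset.sum_le_sum (fun i _ => ?_)
  rw [mul_one_div, div_le_iff₀ (ha i), mul_comm]
  exact hle i
end

section
/- Let ι be a nonempty finite set of users and let N > 0, τ > 0, P > 0 be real numbers, and β, ptot : ι → ℝ with β i > 0 and ptot i > 0 for all i. Call a pair (u, q) of functions ι → ℝ feasible if 0 ≤ u i ≤ ptot i, q i ≥ 0, and ∑_i q i = P. For feasible (u, q) define γ(u, i) = τ·(u i)·(β i)² / (1 + τ·(u i)·(β i)) and the minimum SINR m(u, q) = min_i N·γ(u, i)·(q i) / (1 + (β i)·P). Define γ*(i) = τ·(ptot i)·(β i)² / (1 + τ·(ptot i)·(β i)) and Γ = N·P / (∑_i (1 + (β i)·P)/γ*(i)). Then Γ is the greatest value of m(u, q) over all feasible pairs; it is attained at u i = ptot i and q i = Γ·(1 + (β i)·P)/(N·γ*(i)), and at this optimum every user's SINR N·γ(u, i)·(q i)/(1 + (β i)·P) equals Γ. -/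
open Finset

/-- Theorem 4 (max–min fairness for MRT unicast with dedicated pilots), as a
finite-dimensional optimization problem: the greatest achievable minimum SINR
over feasible uplink training powers `u` and downlink powers `q` equals
`Γ = N·P / ∑ (1 + β i·P)/γ*(i)`, attained at `u = ptot` and
`q i = Γ·(1 + β i·P)/(N·γ*(i))`, where all users' SINRs equal `Γ`. -/
theorem stmt_2 {ι : Type*} [Fintype ι] [Nonempty ι]
    (N τ P : ℝ) (hN : 0 < N) (hτ : 0 < τ) (hP : 0 < P)
    (β ptot : ι → ℝ) (hβ : ∀ i, 0 < β i) (hptot : ∀ i, 0 < ptot i) :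
    let γ : (ι → ℝ) → ι → ℝ := fun u i => τ * u i * β i ^ 2 / (1 + τ * u i * β i)
    let sinr : (ι → ℝ) → (ι → ℝ) → ι → ℝ := fun u q i =>
      N * γ u i * q i / (1 + β i * P)
    let m : (ι → ℝ) → (ι → ℝ) → ℝ := fun u q => univ.inf' univ_nonempty (sinr u q)
    let γs : ι → ℝ := fun i => τ * ptot i * β i ^ 2 / (1 + τ * ptot i * β i)
    let Γ : ℝ := N * P / ∑ i, (1 + β i * P) / γs i
    let qs : ι → ℝ := fun i => Γ * (1 + β i * P) / (N * γs i)
    IsGreatest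
      {v : ℝ | ∃ u q : ι → ℝ, (∀ i, 0 ≤ u i ∧ u i ≤ ptot i) ∧ (∀ i, 0 ≤ q i) ∧
        ∑ i, q i = P ∧ v = m u q} Γ ∧
    (∀ i, 0 ≤ qs i) ∧ (∑ i, qs i = P) ∧ m ptot qs = Γ ∧
    ∀ i, sinr ptot qs i = Γ := by
  intro γ sinr m γs Γ qs
  have hγs : ∀ i, 0 < γs i := fun i => by
    have := hβ i
    have := hptot i
    simp only [γs]
    positivity
  have hb : ∀ i, 0 < 1 + β i * P := fun i => by
    have := hβ i
    positivity
  have hS : 0 < ∑ i, (1 + β i * P) / γs i :=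
    Finset.sum_pos (fun i _ => div_pos (hb i) (hγs i)) univ_nonempty
  have hΓ : 0 < Γ := div_pos (mul_pos hN hP) hS
  have hΓS : Γ * ∑ i, (1 + β i * P) / γs i = N * P := div_mul_cancel₀ _ hS.ne'
  have hq : ∀ i, 0 ≤ qs i := fun i =>
    (div_pos (mul_pos hΓ (hb i)) (mul_pos hN (hγs i))).le
  have hsum : ∑ i, qs i = P := by
    have h1 : ∀ i, qs i = Γ / N * ((1 + β i * P) / γs i) := fun i =>
      mul_div_mul_comm _ _ _ _
    rw [Finset.sum_congr rfl (fun i _ => h1 i), ← Finset.mul_sum, div_mul_eq_mul_div, hΓS]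
    exact mul_div_cancel_left₀ _ hN.ne'
  have hs : ∀ i, sinr ptot qs i = Γ := fun i => by
    have h1 := (hγs i).ne'
    have h2 := (hb i).ne'
    have h3 := hN.ne'
    change N * γs i * (Γ * (1 + β i * P) / (N * γs i)) / (1 + β i * P) = Γ
    rw [mul_div_cancel₀ _ (mul_ne_zero h3 h1), mul_div_cancel_right₀ _ h2]
  have hm : m ptot qs = Γ := by
    apply le_antisymm
    · obtain ⟨i⟩ := ‹Nonempty ι›
      exact (Finset.inf'_le _ (mem_univ i)).trans (hs i).le
    · exact Finset.le_inf' _ _ fun i _ => (hs i).ge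
  refine ⟨⟨⟨ptot, qs, fun i => ⟨(hptot i).le, le_rfl⟩, hq, hsum, hm.symm⟩, ?_⟩, hq, hsum, hm, hs⟩
  rintro v ⟨u, q, hu, hq0, hqP, rfl⟩
  have key : ∀ i, m u q * ((1 + β i * P) / γs i) ≤ N * q i := fun i => by
    have h1 : m u q ≤ sinr u q i := Finset.inf'_le _ (mem_univ i)
    have h2 : γ u i ≤ γs i := by
      have hb := hβ i
      have hp := hptot i
      obtain ⟨hu0, hu1⟩ := hu i
      simp only [γ, γs]
      rw [div_le_div_iff₀ (by positivity) (by positivity)]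
      have : 0 ≤ τ * β i ^ 2 * (ptot i - u i) :=
        mul_nonneg (by positivity) (by linarith)
      nlinarith
    have h3 : m u q * (1 + β i * P) ≤ N * γ u i * q i := (le_div_iff₀ (hb i)).1 h1
    have h4 : N * γ u i * q i ≤ N * γs i * q i :=
      mul_le_mul_of_nonneg_right (mul_le_mul_of_nonneg_left h2 hN.le) (hq0 i)
    rw [← mul_div_assoc, div_le_iff₀ (hγs i)]
    linarith
  have h5 := Finset.sum_le_sum (s := univ) fun i _ => key i
  rw [← Finset.mul_sum, ← Finset.mul_sum, hqP] at h5
  exact (le_div_iff₀ hS).2 h5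
end

section
/- Let ι be a nonempty finite set of users, let M > 0, τ > 0, P > 0 be real numbers, and β, ptot : ι → ℝ with β i > 0 and ptot i > 0 for all i. Call a pair (u, q) of functions ι → ℝ feasible if 0 ≤ u i ≤ ptot i, q i ≥ 0, and ∑_i q i = P. For feasible (u, q) define γ(u, i) = τ·(u i)·(β i)² / (1 + τ·(u i)·(β i)) and the minimum SINR m(u, q) = min_i M·γ(u, i)·(q i) / (1 + (β i − γ(u, i))·P). Define γ*(i) = τ·(ptot i)·(β i)² / (1 + τ·(ptot i)·(β i)) and Γ = M·P / (∑_i (1 + (β i − γ*(i))·P)/γ*(i)). Then Γ is the greatest value of m(u, q) over all feasible pairs; it is attained at u i = ptot i and q i = Γ·(1 + (β i − γ*(i))·P)/(γ*(i)·M), and at this optimum every user's SINR equals Γ. -/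
open Finset

/-- Theorem 5 (max–min fairness for zero-forcing unicast with dedicated pilots):
with array gain `M = N − K_tot > 0`, the greatest achievable minimum SINR over
feasible `(u, q)` equals `Γ = M·P / ∑ (1 + (β i − γ*(i))·P)/γ*(i)`, attained at
`u = ptot` and `q i = Γ·(1 + (β i − γ*(i))·P)/(γ*(i)·M)`, where all users' SINRs
equal `Γ`. -/
theorem stmt_3 {ι : Type*} [Fintype ι] [Nonempty ι]
    (M τ P : ℝ) (hM : 0 < M) (hτ : 0 < τ) (hP : 0 < P)
    (β ptot : ι → ℝ) (hβ : ∀ i, 0 < β i) (hptot : ∀ i, 0 < ptot i) :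
    let γ : (ι → ℝ) → ι → ℝ := fun u i => τ * u i * β i ^ 2 / (1 + τ * u i * β i)
    let sinr : (ι → ℝ) → (ι → ℝ) → ι → ℝ := fun u q i =>
      M * γ u i * q i / (1 + (β i - γ u i) * P)
    let m : (ι → ℝ) → (ι → ℝ) → ℝ := fun u q => univ.inf' univ_nonempty (sinr u q)
    let γs : ι → ℝ := fun i => τ * ptot i * β i ^ 2 / (1 + τ * ptot i * β i)
    let Γ : ℝ := M * P / ∑ i, (1 + (β i - γs i) * P) / γs i
    let qs : ι → ℝ := fun i => Γ * (1 + (β i - γs i) * P) / (γs i * M)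
    IsGreatest
      {v : ℝ | ∃ u q : ι → ℝ, (∀ i, 0 ≤ u i ∧ u i ≤ ptot i) ∧ (∀ i, 0 ≤ q i) ∧
        ∑ i, q i = P ∧ v = m u q} Γ ∧
    (∀ i, 0 ≤ qs i) ∧ (∑ i, qs i = P) ∧ m ptot qs = Γ ∧
    ∀ i, sinr ptot qs i = Γ := by
  intro γ sinr m γs Γ qs
  have hγs : ∀ i, 0 < γs i := fun i => by
    have := hβ i; have := hptot i
    simp only [γs]; positivity
  have hγlt : ∀ i, γs i < β i := fun i => by
    have h1 := hβ i; have h2 := hptot i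
    have h3 : 0 < τ * ptot i * β i := by positivity
    simp only [γs]
    rw [div_lt_iff₀ (by positivity)]
    nlinarith
  have hD : ∀ i, 0 < 1 + (β i - γs i) * P := fun i => by
    have := mul_pos (sub_pos.2 (hγlt i)) hP
    linarith
  have hS : 0 < ∑ i, (1 + (β i - γs i) * P) / γs i :=
    Finset.sum_pos (fun i _ => div_pos (hD i) (hγs i)) univ_nonempty
  have hΓ : 0 < Γ := div_pos (mul_pos hM hP) hS
  have hΓS : Γ * ∑ i, (1 + (β i - γs i) * P) / γs i = M * P := div_mul_cancel₀ _ hS.ne'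
  have hq0 : ∀ i, 0 ≤ qs i := fun i =>
    (div_pos (mul_pos hΓ (hD i)) (mul_pos (hγs i) hM)).le
  have hqs : ∑ i, qs i = P := by
    have h : ∀ i, qs i = Γ / M * ((1 + (β i - γs i) * P) / γs i) := fun i => by
      simp only [qs]
      rw [div_mul_div_comm, mul_comm (γs i) M]
    rw [Finset.sum_congr rfl (fun i _ => h i), ← Finset.mul_sum, div_mul_eq_mul_div, hΓS]
    field_simp
  have hsinr : ∀ i, sinr ptot qs i = Γ := fun i => by
    change M * γs i * (Γ * (1 + (β i - γs i) * P) / (γs i * M)) / (1 + (β i - γs i) * P) = Γ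
    have h1 := (hD i).ne'
    have h2 := (hγs i).ne'
    generalize 1 + (β i - γs i) * P = D at *
    generalize γs i = g at *
    field_simp
  have hm : m ptot qs = Γ := by
    apply le_antisymm
    · obtain ⟨i⟩ := ‹Nonempty ι›
      exact (Finset.inf'_le _ (mem_univ i)).trans (hsinr i).le
    · exact Finset.le_inf' _ _ fun i _ => (hsinr i).ge
  refine ⟨⟨⟨ptot, qs, fun i => ⟨(hptot i).le, le_rfl⟩, hq0, hqs, hm.symm⟩, ?_⟩,
    hq0, hqs, hm, hsinr⟩
  rintro v ⟨u, q, hu, hq, hqP, rfl⟩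
  have key : ∀ i, m u q * ((1 + (β i - γs i) * P) / γs i) ≤ M * q i := fun i => by
    have hle : γ u i ≤ γs i := by
      have h1 := hβ i
      have h2 := hptot i
      obtain ⟨h3, h4⟩ := hu i
      simp only [γ, γs]
      rw [div_le_div_iff₀ (by positivity) (by positivity)]
      have : 0 ≤ τ * β i ^ 2 * (ptot i - u i) :=
        mul_nonneg (by positivity) (sub_nonneg.2 h4)
      nlinarith
    have h5 : m u q ≤ M * γs i * q i / (1 + (β i - γs i) * P) := by
      refine (Finset.inf'_le _ (mem_univ i)).trans ?_
      have h6 := hD i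
      have h7 := hq i
      have h8 := hγs i
      simp only [sinr]
      gcongr
    rw [le_div_iff₀ (hD i)] at h5
    rw [← mul_div_assoc, div_le_iff₀ (hγs i)]
    linarith
  have := Finset.sum_le_sum fun i (_ : i ∈ univ) => key i
  rw [← Finset.mul_sum, ← Finset.mul_sum, hqP] at this
  exact (le_div_iff₀ hS).2 this
end

section
/- Let G be a nonempty finite set of groups, and for each i ∈ G let K i be a nonempty finite set of users, with user pairs (i, k) indexing all users; write |K i| for the cardinality of K i, K_tot = ∑_i |K i|, and ν i = K_tot − |K i|. Let N, τ, P be reals with τ > 0, P > 0 and N > ν i for all i, and let β, ptot be positive real functions on the user pairs. Define γ*(i,k) = τ·ptot(i,k)·β(i,k)² / (1 + τ·ptot(i,k)·β(i,k)) and Δ i = ∑_{k ∈ K i} ((1 + P·β(i,k))/γ*(i,k) − P). Suppose Γ ≥ 0 satisfies Γ < (N − ν i)/|K i| for all i and P = ∑_{i ∈ G} Γ·Δ i / (N − ν i − Γ·|K i|). Call (u, q) feasible if 0 ≤ u(i,k) ≤ ptot(i,k), q(i,k) ≥ 0, and ∑_{i,k} q(i,k) = P; its minimum SINR is the minimum over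 all user pairs (i,k) of (N − ν i)·γ(u,i,k)·q(i,k) / (1 + γ(u,i,k)·∑_{m ∈ K i} q(i,m) + (β(i,k) − γ(u,i,k))·P), where γ(u,i,k) = τ·u(i,k)·β(i,k)²/(1 + τ·u(i,k)·β(i,k)). Then Γ is the greatest value of the minimum SINR over all feasible pairs; it is attained at u = ptot and q(i,k) = (Γ/(N − ν i))·((1 + P·β(i,k))/γ*(i,k) − P + P_i) with P_i = Γ·Δ i/(N − ν i − Γ·|K i|), and at this optimum every user's SINR equals Γ. -/
open Finset

theorem aux_gamma {t u b : ℝ} (ht : 0 < t) (hu : 0 ≤ u) (hb : 0 < b) :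
    0 ≤ t * u * b ^ 2 / (1 + t * u * b) ∧ t * u * b ^ 2 / (1 + t * u * b) < b := by
  have h : 0 ≤ t * u * b := by positivity
  refine ⟨by positivity, ?_⟩
  rw [div_lt_iff₀ (by linarith)]
  nlinarith

theorem aux_mono {t u p b : ℝ} (ht : 0 < t) (hu : 0 ≤ u) (hup : u ≤ p) (hb : 0 < b) :
    t * u * b ^ 2 / (1 + t * u * b) ≤ t * p * b ^ 2 / (1 + t * p * b) := by
  have h : 0 ≤ t * u * b := by positivity
  have h1 : t * u * b ≤ t * p * b := by gcongr
  rw [div_le_div_iff₀ (by linarith) (by linarith)]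
  nlinarith

/-- the per-user strict lower bound on the downlink power -/
theorem aux_user {A g gs b P Q q Γ v : ℝ} (hP : 0 < P) (hQ : 0 ≤ Q)
    (hb : 0 < b) (hg : 0 ≤ g) (hggs : g ≤ gs) (hgs : gs < b) (hΓ : 0 ≤ Γ) (hv : Γ < v)
    (h : v ≤ A * g * q / (1 + g * Q + (b - g) * P)) :
    Γ * ((1 + P * b) / gs - P + Q) < A * q := by
  have hD : 0 < 1 + g * Q + (b - g) * P := by
    have := mul_nonneg hg hQ
    have : 0 ≤ (b - g) * P := mul_nonneg (by linarith) hP.le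
    linarith
  rw [le_div_iff₀ hD] at h
  have hlt : Γ * (1 + g * Q + (b - g) * P) < A * g * q :=
    lt_of_lt_of_le (mul_lt_mul_of_pos_right hv hD) h
  have hg0 : 0 < g := by
    rcases hg.lt_or_eq with h0 | h0
    · exact h0
    · subst h0
      have := mul_nonneg hΓ hD.le
      simp at hlt this
      linarith
  have h1 : (1 + P * b) / gs ≤ (1 + P * b) / g := by
    have : 0 < P * b := by positivity
    gcongr
  have h2 : Γ * ((1 + P * b) / g - P + Q) < A * q := by
    have e : g * ((1 + P * b) / g - P + Q) = 1 + g * Q + (b - g) * P := by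
      field_simp
      ring
    rw [← e] at hlt
    refine lt_of_mul_lt_mul_left (a := g) ?_ hg
    linarith
  have h3 := mul_le_mul_of_nonneg_left h1 hΓ
  linarith


/-- Theorem 6 (max–min fairness for zero-forcing multicast with dedicated pilots):
users are partitioned into multicast groups `K i`, `i ∈ G`; if `Γ ≥ 0` satisfies
`Γ < (N − ν i)/|K i|` for all `i` and the fixed-point equation
`P = ∑ i Γ·Δ i/(N − ν i − Γ·|K i|)`, then `Γ` is the greatest achievable minimum
SINR over feasible `(u, q)`, attained at `u = ptot` and the stated downlink
powers, where all users' SINRs equal `Γ`. -/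
theorem stmt_4 {G : Type*} [Fintype G] [Nonempty G]
    (K : G → Type*) [∀ i, Fintype (K i)] [∀ i, Nonempty (K i)]
    (N τ P : ℝ) (hτ : 0 < τ) (hP : 0 < P)
    (β ptot : ∀ i, K i → ℝ) (hβ : ∀ i k, 0 < β i k) (hptot : ∀ i k, 0 < ptot i k)
    (hN : ∀ i, (∑ j, (Fintype.card (K j) : ℝ)) - Fintype.card (K i) < N) :
    haveI : Nonempty ((i : G) × K i) :=
      ⟨⟨Classical.arbitrary G, Classical.arbitrary _⟩⟩
    let ν : G → ℝ := fun i => (∑ j, (Fintype.card (K j) : ℝ)) - Fintype.card (K i)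
    let γ : (∀ i, K i → ℝ) → ∀ i, K i → ℝ := fun u i k =>
      τ * u i k * β i k ^ 2 / (1 + τ * u i k * β i k)
    let γs : ∀ i, K i → ℝ := fun i k =>
      τ * ptot i k * β i k ^ 2 / (1 + τ * ptot i k * β i k)
    let Δ : G → ℝ := fun i => ∑ k, ((1 + P * β i k) / γs i k - P)
    let sinr : (∀ i, K i → ℝ) → (∀ i, K i → ℝ) → ∀ i, K i → ℝ := fun u q i k =>
      (N - ν i) * γ u i k * q i k /
        (1 + γ u i k * (∑ m, q i m) + (β i k - γ u i k) * P)
    let m : (∀ i, K i → ℝ) → (∀ i, K i → ℝ) → ℝ := fun u q =>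
      univ.inf' univ_nonempty (fun s : Σ i, K i => sinr u q s.1 s.2)
    ∀ Γ : ℝ, 0 ≤ Γ →
      (∀ i, Γ < (N - ν i) / (Fintype.card (K i) : ℝ)) →
      P = ∑ i, Γ * Δ i / (N - ν i - Γ * (Fintype.card (K i) : ℝ)) →
      let Pgrp : G → ℝ := fun i => Γ * Δ i / (N - ν i - Γ * (Fintype.card (K i) : ℝ))
      let qs : ∀ i, K i → ℝ := fun i k =>
        (Γ / (N - ν i)) * ((1 + P * β i k) / γs i k - P + Pgrp i)
      IsGreatest
        {v : ℝ | ∃ u q : ∀ i, K i → ℝ,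
          (∀ i k, 0 ≤ u i k ∧ u i k ≤ ptot i k) ∧ (∀ i k, 0 ≤ q i k) ∧
          (∑ i, ∑ k, q i k) = P ∧ v = m u q} Γ ∧
      (∀ i k, 0 ≤ qs i k) ∧ (∑ i, ∑ k, qs i k) = P ∧ m ptot qs = Γ ∧
      ∀ i k, sinr ptot qs i k = Γ := by
  intro ν γ γs Δ sinr m Γ hΓ hΓlt hfix Pgrp qs
  have hA : ∀ i, 0 < N - ν i := fun i => sub_pos.2 (hN i)
  have hc : ∀ i, 0 < (Fintype.card (K i) : ℝ) := fun i => by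
    exact_mod_cast Fintype.card_pos
  have hB : ∀ i, 0 < N - ν i - Γ * (Fintype.card (K i) : ℝ) := fun i => by
    have := hΓlt i
    rw [lt_div_iff₀ (hc i)] at this
    linarith
  have hgs0 : ∀ i k, 0 < γs i k := fun i k => by
    have := hβ i k
    have := hptot i k
    simp only [γs]
    positivity
  have hgsb : ∀ i k, γs i k < β i k := fun i k =>
    (aux_gamma hτ (hptot i k).le (hβ i k)).2
  have ha : ∀ i k, 0 < (1 + P * β i k) / γs i k - P := fun i k => by
    rw [sub_pos, lt_div_iff₀ (hgs0 i k)]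
    have := mul_lt_mul_of_pos_left (hgsb i k) hP
    linarith
  have hΔ : ∀ i, 0 ≤ Δ i := fun i => Finset.sum_nonneg fun k _ => (ha i k).le
  have hPg : ∀ i, 0 ≤ Pgrp i := fun i => div_nonneg (mul_nonneg hΓ (hΔ i)) (hB i).le
  have hPe : ∀ i, Pgrp i * (N - ν i - Γ * (Fintype.card (K i) : ℝ)) = Γ * Δ i := fun i =>
    div_mul_cancel₀ _ (hB i).ne'
  have hsumc : ∀ i (x : ℝ), ∑ k, ((1 + P * β i k) / γs i k - P + x)
      = Δ i + Fintype.card (K i) * x := fun i x => by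
    rw [Finset.sum_add_distrib]
    simp [Δ]
  have hqs0 : ∀ i k, 0 ≤ qs i k := fun i k =>
    mul_nonneg (div_nonneg hΓ (hA i).le) (add_nonneg (ha i k).le (hPg i))
  have hqsum : ∀ i, ∑ k, qs i k = Pgrp i := fun i => by
    simp only [qs]
    rw [← Finset.mul_sum, hsumc, div_mul_eq_mul_div, div_eq_iff (hA i).ne']
    linarith [hPe i]
  have hqtot : ∑ i, ∑ k, qs i k = P := by
    rw [Finset.sum_congr rfl fun i _ => hqsum i]
    exact hfix.symm
  have hsinr : ∀ i k, sinr ptot qs i k = Γ := fun i k => by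
    have e : sinr ptot qs i k = (N - ν i) * γs i k * qs i k /
        (1 + γs i k * (∑ m, qs i m) + (β i k - γs i k) * P) := rfl
    have hg := hgs0 i k
    have hD : 0 < 1 + γs i k * Pgrp i + (β i k - γs i k) * P := by
      have := mul_nonneg hg.le (hPg i)
      have := mul_pos (sub_pos.2 (hgsb i k)) hP
      linarith
    rw [e, hqsum, div_eq_iff hD.ne']
    have e1 : (N - ν i) * qs i k = Γ * ((1 + P * β i k) / γs i k - P + Pgrp i) := by
      simp only [qs]
      rw [← mul_assoc, mul_div_cancel₀ _ (hA i).ne']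
    have e2 : γs i k * ((1 + P * β i k) / γs i k) = 1 + P * β i k :=
      mul_div_cancel₀ _ hg.ne'
    linear_combination γs i k * e1 + Γ * e2
  have hm : m ptot qs = Γ := by
    simp only [m, hsinr]
    exact Finset.inf'_const _ _
  refine ⟨⟨⟨ptot, qs, fun i k => ⟨(hptot i k).le, le_rfl⟩, hqs0, hqtot, hm.symm⟩, ?_⟩,
    hqs0, hqtot, hm, hsinr⟩
  rintro v ⟨u, q, hu, hq, hqP, rfl⟩
  by_contra hlt
  push Not at hlt
  have hle : ∀ i k, m u q ≤ sinr u q i k := fun i k =>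
    Finset.inf'_le (fun s : Σ i, K i => sinr u q s.1 s.2) (Finset.mem_univ (⟨i, k⟩ : Σ i, K i))
  have key : ∀ i, Pgrp i < ∑ k, q i k := fun i => by
    have h1 : ∑ k, Γ * ((1 + P * β i k) / γs i k - P + ∑ m, q i m)
        < ∑ k, (N - ν i) * q i k :=
      Finset.sum_lt_sum_of_nonempty Finset.univ_nonempty fun k _ =>
        aux_user hP (Finset.sum_nonneg fun k _ => hq i k) (hβ i k)
          (aux_gamma hτ (hu i k).1 (hβ i k)).1
          (aux_mono hτ (hu i k).1 (hu i k).2 (hβ i k)) (hgsb i k) hΓ hlt (hle i k)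
    rw [← Finset.mul_sum, ← Finset.mul_sum, hsumc] at h1
    refine (div_lt_iff₀ (hB i)).2 ?_
    linarith
  have := Finset.sum_lt_sum_of_nonempty (Finset.univ_nonempty (α := G)) fun i _ => key i
  rw [hqP] at this
  exact absurd hfix this.ne'
end

section
/- Let G be a nonempty finite set of groups, and for each i ∈ G let K i be a nonempty finite set of users. Let N > 0, τ > 0, P > 0 be reals and let β, ptot be positive real functions on the user pairs (i, k). Call a pair (u, d) feasible if u is a real function on user pairs with 0 ≤ u(i,k) ≤ ptot(i,k), and d : G → ℝ satisfies d i ≥ 0 and ∑_i d i = P. For feasible (u, d) define γcp(u,i,k) = τ·u(i,k)·β(i,k)² / (1 + τ·∑_{m ∈ K i} u(i,m)·β(i,m)) and the minimum SINR as the minimum over user pairs of N·γcp(u,i,k)·(d i)/(1 + β(i,k)·P). Define Υ i = min_{k ∈ K i} ptot(i,k)·β(i,k)²/(1 + P·β(i,k)), u*(i,k) = (1 + P·β(i,k))·Υ i/β(i,k)², S i = ∑_{m ∈ K i} u*(i,m)·β(i,m), and Γ = N·P / (∑_{i} (1 + τ·S i)/(τ·Υ i)). Then Γ is the greatest value of the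 minimum SINR over all feasible pairs; it is attained at u = u* and d i = Γ·(1 + τ·S i)/(τ·N·Υ i), and at this optimum every user's SINR equals Γ. -/
open Finset

/-- Theorem 7 (max–min fairness for MRT multicast with co-pilot assignment):
users are partitioned into multicast groups `K i`, with co-pilot estimation
quality `γcp(u,i,k) = τ·u(i,k)·β(i,k)² / (1 + τ·∑_m u(i,m)·β(i,m))` and per-group
downlink powers `d`. The greatest achievable minimum SINR equals
`Γ = N·P / ∑ (1 + τ·S i)/(τ·Υ i)`, attained at `u = u*` and
`d i = Γ·(1 + τ·S i)/(τ·N·Υ i)`, where all users' SINRs equal `Γ`. -/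
theorem stmt_6 {G : Type*} [Fintype G] [Nonempty G]
    (K : G → Type*) [∀ i, Fintype (K i)] [∀ i, Nonempty (K i)]
    (N τ P : ℝ) (hN : 0 < N) (hτ : 0 < τ) (hP : 0 < P)
    (β ptot : ∀ i, K i → ℝ) (hβ : ∀ i k, 0 < β i k) (hptot : ∀ i k, 0 < ptot i k) :
    haveI : Nonempty ((i : G) × K i) :=
      ⟨⟨Classical.arbitrary G, Classical.arbitrary _⟩⟩
    let γcp : (∀ i, K i → ℝ) → ∀ i, K i → ℝ := fun u i k =>
      τ * u i k * β i k ^ 2 / (1 + τ * ∑ m, u i m * β i m)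
    let sinr : (∀ i, K i → ℝ) → (G → ℝ) → ∀ i, K i → ℝ := fun u d i k =>
      N * γcp u i k * d i / (1 + β i k * P)
    let m : (∀ i, K i → ℝ) → (G → ℝ) → ℝ := fun u d =>
      univ.inf' univ_nonempty (fun s : Σ i, K i => sinr u d s.1 s.2)
    let Υ : G → ℝ := fun i =>
      univ.inf' univ_nonempty (fun k : K i => ptot i k * β i k ^ 2 / (1 + P * β i k))
    let us : ∀ i, K i → ℝ := fun i k => (1 + P * β i k) * Υ i / β i k ^ 2
    let S : G → ℝ := fun i => ∑ m, us i m * β i m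
    let Γ : ℝ := N * P / ∑ i, (1 + τ * S i) / (τ * Υ i)
    let ds : G → ℝ := fun i => Γ * (1 + τ * S i) / (τ * N * Υ i)
    IsGreatest
      {v : ℝ | ∃ (u : ∀ i, K i → ℝ) (d : G → ℝ),
        (∀ i k, 0 ≤ u i k ∧ u i k ≤ ptot i k) ∧ (∀ i, 0 ≤ d i) ∧
        (∑ i, d i) = P ∧ v = m u d} Γ ∧
    (∀ i k, 0 ≤ us i k ∧ us i k ≤ ptot i k) ∧ (∀ i, 0 ≤ ds i) ∧
    (∑ i, ds i) = P ∧ m us ds = Γ ∧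
    ∀ i k, sinr us ds i k = Γ := by
  intro γcp sinr m Υ us S Γ ds
  have hb : ∀ i k, 0 < 1 + P * β i k := fun i k => by
    have := mul_pos hP (hβ i k); linarith
  have hΥ : ∀ i, 0 < Υ i := fun i => by
    refine (Finset.lt_inf'_iff _).2 fun k _ => ?_
    exact div_pos (mul_pos (hptot i k) (pow_pos (hβ i k) 2)) (hb i k)
  have hΥle : ∀ i k, Υ i ≤ ptot i k * β i k ^ 2 / (1 + P * β i k) := fun i k =>
    Finset.inf'_le (fun k : K i => ptot i k * β i k ^ 2 / (1 + P * β i k)) (Finset.mem_univ k)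
  have hus : ∀ i k, 0 < us i k := fun i k =>
    div_pos (mul_pos (hb i k) (hΥ i)) (pow_pos (hβ i k) 2)
  have husle : ∀ i k, us i k ≤ ptot i k := fun i k => by
    have h := hΥle i k
    rw [le_div_iff₀ (hb i k)] at h
    refine (div_le_iff₀ (pow_pos (hβ i k) 2)).2 ?_
    linarith
  have hS : ∀ i, 0 ≤ S i := fun i =>
    Finset.sum_nonneg fun k _ => (mul_pos (hus i k) (hβ i k)).le
  have hS1 : ∀ i, 0 < 1 + τ * S i := fun i => by
    have := mul_nonneg hτ.le (hS i); linarith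
  have hD : 0 < ∑ i, (1 + τ * S i) / (τ * Υ i) :=
    Finset.sum_pos (fun i _ => div_pos (hS1 i) (mul_pos hτ (hΥ i))) Finset.univ_nonempty
  have hΓ : 0 < Γ := div_pos (mul_pos hN hP) hD
  have hds : ∀ i, 0 ≤ ds i := fun i =>
    (div_pos (mul_pos hΓ (hS1 i)) (mul_pos (mul_pos hτ hN) (hΥ i))).le
  have hΓD : Γ * ∑ i, (1 + τ * S i) / (τ * Υ i) = N * P := div_mul_cancel₀ _ hD.ne'
  have hsum : ∑ i, ds i = P := by
    have h1 : ∑ i, ds i = (Γ / N) * ∑ i, (1 + τ * S i) / (τ * Υ i) := by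
      rw [Finset.mul_sum]
      refine Finset.sum_congr rfl fun i _ => ?_
      have := (hΥ i).ne'
      change Γ * (1 + τ * S i) / (τ * N * Υ i) = _
      field_simp
    rw [h1, div_mul_eq_mul_div, hΓD]
    field_simp
  have hsinr : ∀ i k, sinr us ds i k = Γ := fun i k => by
    change N * (τ * ((1 + P * β i k) * Υ i / β i k ^ 2) * β i k ^ 2 / (1 + τ * S i)) *
      (Γ * (1 + τ * S i) / (τ * N * Υ i)) / (1 + β i k * P) = Γ
    have h1 := (hΥ i).ne'
    have h2 := (hb i k).ne'
    have h3 := (hS1 i).ne'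
    have h4 := (hβ i k).ne'
    rw [mul_comm (β i k) P]
    generalize 1 + τ * S i = a at *
    generalize 1 + P * β i k = b at *
    field_simp
  have hm : m us ds = Γ := by
    apply le_antisymm
    · refine (Finset.inf'_le _ (Finset.mem_univ
        (⟨Classical.arbitrary G, Classical.arbitrary _⟩ : (i : G) × K i))).trans ?_
      exact (hsinr _ _).le
    · exact Finset.le_inf' _ _ fun s _ => (hsinr s.1 s.2).ge
  refine ⟨⟨⟨us, ds, fun i k => ⟨(hus i k).le, husle i k⟩, hds, hsum, hm.symm⟩, ?_⟩,
    fun i k => ⟨(hus i k).le, husle i k⟩, hds, hsum, hm, hsinr⟩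
  rintro v ⟨u, d, hu, hd, hdP, hv⟩
  rcases le_or_gt v 0 with hv0 | hv0
  · exact hv0.trans hΓ.le
  have hvle : ∀ i k, v ≤ sinr u d i k := fun i k => by
    rw [hv]
    exact Finset.inf'_le (fun s : (i : G) × K i => sinr u d s.1 s.2) (Finset.mem_univ ⟨i, k⟩)
  refine (le_div_iff₀ hD).2 ?_
  rw [← hdP, Finset.mul_sum, Finset.mul_sum]
  refine Finset.sum_le_sum fun i _ => ?_
  obtain ⟨k, -, hk⟩ := Finset.exists_min_image Finset.univ
    (fun k : K i => u i k * β i k ^ 2 / (1 + P * β i k)) Finset.univ_nonempty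
  obtain ⟨t, ht⟩ : ∃ t, t = u i k * β i k ^ 2 / (1 + P * β i k) := ⟨_, rfl⟩
  have ht0 : 0 ≤ t := by
    rw [ht]; exact div_nonneg (mul_nonneg (hu i k).1 (sq_nonneg _)) (hb i k).le
  have htle : ∀ l, t ≤ u i l * β i l ^ 2 / (1 + P * β i l) := fun l => by
    rw [ht]; exact hk l (Finset.mem_univ l)
  have htΥ : t ≤ Υ i := Finset.le_inf' _ _ fun l _ => (htle l).trans (by
    have := hb i l
    have := (hu i l).2
    gcongr)
  obtain ⟨C, hC⟩ : ∃ C, C = ∑ l, (1 + P * β i l) / β i l := ⟨_, rfl⟩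
  have hSC : S i = Υ i * C := by
    rw [hC, Finset.mul_sum]
    refine Finset.sum_congr rfl fun l _ => ?_
    change (1 + P * β i l) * Υ i / β i l ^ 2 * β i l = _
    have := (hβ i l).ne'
    field_simp
  have hUC : t * C ≤ ∑ l, u i l * β i l := by
    rw [hC, Finset.mul_sum]
    refine Finset.sum_le_sum fun l _ => ?_
    have h := htle l
    have h1 := hβ i l
    rw [le_div_iff₀ (hb i l)] at h
    rw [← mul_div_assoc, div_le_iff₀ h1]
    linarith
  have hU0 : 0 ≤ ∑ l, u i l * β i l :=
    Finset.sum_nonneg fun l _ => mul_nonneg (hu i l).1 (hβ i l).le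
  have hU1 : 0 < 1 + τ * ∑ l, u i l * β i l := by
    have := mul_nonneg hτ.le hU0; linarith
  have h1 : v * (1 + τ * ∑ l, u i l * β i l) ≤ N * τ * t * d i := by
    have h := hvle i k
    have e : sinr u d i k = N * τ * t * d i / (1 + τ * ∑ l, u i l * β i l) := by
      change N * (τ * u i k * β i k ^ 2 / (1 + τ * ∑ l, u i l * β i l)) * d i
        / (1 + β i k * P) = _
      rw [ht, mul_comm (β i k) P]
      have h2 := (hb i k).ne'
      have h3 := hU1.ne'
      generalize 1 + τ * ∑ l, u i l * β i l = a at *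
      generalize 1 + P * β i k = b at *
      field_simp
    rwa [e, le_div_iff₀ hU1] at h
  have h2 : v * (1 + τ * (t * C)) ≤ N * τ * t * d i := le_trans (by gcongr) h1
  have htpos : 0 < t := by
    rcases ht0.lt_or_eq with h | h
    · exact h
    · rw [← h] at h2
      simp at h2
      linarith
  rw [← mul_div_assoc, div_le_iff₀ (mul_pos hτ (hΥ i)), hSC]
  refine le_of_mul_le_mul_left ?_ htpos
  have h3 := mul_le_mul_of_nonneg_left h2 (hΥ i).le
  have h4 := mul_le_mul_of_nonneg_left htΥ hv0.le
  linarith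
end

section
/- Let G be a nonempty finite set of groups, and for each i ∈ G let K i be a nonempty finite set of users. Let M > 0, τ > 0, P > 0 be reals and let β, ptot be positive real functions on the user pairs (i, k). Call a pair (u, d) feasible if 0 ≤ u(i,k) ≤ ptot(i,k), d i ≥ 0, and ∑_i d i = P. For feasible (u, d) define γcp(u,i,k) = τ·u(i,k)·β(i,k)² / (1 + τ·∑_{m ∈ K i} u(i,m)·β(i,m)) and the minimum SINR as the minimum over user pairs of M·γcp(u,i,k)·(d i)/(1 + (β(i,k) − γcp(u,i,k))·P). Define Υ i = min_{k ∈ K i} ptot(i,k)·β(i,k)²/(1 + P·β(i,k)), u*(i,k) = (1 + P·β(i,k))·Υ i/β(i,k)², E i = |K i|·Υ i·P + Υ i·∑_{m ∈ K i} 1/β(i,m), Δ i = τ·Υ i/(1 + τ·(E i − P·Υ i)), and Γ = P·M / (∑_{i} 1/Δ i). Then Γ is the greatest value of the minimum SINR over all feasible pairs; it is attained at u = u* and d i = P / (Δ i · ∑_{j} 1/Δ j), and at this optimum every user's SINR equals Γ. -/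
open Finset

lemma aux_sinr (M τ P β u S d x : ℝ) (hβ : 0 < β) (hP : 0 < P) (hS : 0 < S)
    (hx : u * β ^ 2 = x * (1 + P * β)) (hD : 0 < S - τ * P * x) :
    M * (τ * u * β ^ 2 / S) * d / (1 + (β - τ * u * β ^ 2 / S) * P)
      = M * d * (τ * x / (S - τ * P * x)) := by
  have h1 : 0 < 1 + P * β := by positivity
  have e : τ * u * β ^ 2 = τ * x * (1 + P * β) := by rw [mul_assoc, hx]; ring
  rw [e]
  have e2 : 1 + (β - τ * x * (1 + P * β) / S) * P = (1 + P * β) * (S - τ * P * x) / S := by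
    field_simp
    ring
  rw [e2]
  have := hD.ne'
  field_simp

lemma aux_sum {K : Type*} [Fintype K] (P : ℝ) (β u x : K → ℝ) (hβ : ∀ k, 0 < β k)
    (hx : ∀ k, u k * β k ^ 2 = x k * (1 + P * β k)) :
    ∑ m, u m * β m = ∑ m, x m * (P + 1 / β m) := by
  refine Finset.sum_congr rfl fun m _ => ?_
  have h := (hβ m).ne'
  field_simp
  linarith [hx m]

lemma aux_C {K : Type*} [Fintype K] [Nonempty K] (P : ℝ) (hP : 0 < P) (β : K → ℝ)
    (hβ : ∀ k, 0 < β k) : 0 < ∑ m, (P + 1 / β m) - P := by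
  obtain ⟨k⟩ := ‹Nonempty K›
  have h := Finset.single_le_sum (f := fun m => P + 1 / β m) (s := Finset.univ)
    (fun m _ => by have := hβ m; positivity) (Finset.mem_univ k)
  have h2 : 0 < 1 / β k := by have := hβ k; positivity
  linarith

lemma aux_us {K : Type*} [Fintype K] [Nonempty K] (M τ P d Y : ℝ) (hτ : 0 < τ) (hP : 0 < P)
    (hY : 0 < Y) (β u : K → ℝ) (hβ : ∀ k, 0 < β k)
    (hu : ∀ k, u k * β k ^ 2 = Y * (1 + P * β k)) (k : K) :
    M * (τ * u k * β k ^ 2 / (1 + τ * ∑ m, u m * β m)) * d /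
      (1 + (β k - τ * u k * β k ^ 2 / (1 + τ * ∑ m, u m * β m)) * P)
      = M * d * (τ * Y / (1 + τ * (Y * (∑ m, (P + 1 / β m) - P)))) := by
  have hC := aux_C P hP β hβ
  have hs : ∑ m, u m * β m = Y * ∑ m, (P + 1 / β m) := by
    rw [aux_sum P β u (fun _ => Y) hβ hu, Finset.mul_sum]
  have hD : 1 + τ * ∑ m, u m * β m - τ * P * Y
      = 1 + τ * (Y * (∑ m, (P + 1 / β m) - P)) := by rw [hs]; ring
  have hD' : 0 < 1 + τ * ∑ m, u m * β m - τ * P * Y := by rw [hD]; positivity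
  have hS : 0 < 1 + τ * ∑ m, u m * β m := by
    have : 0 < τ * P * Y := by positivity
    linarith
  rw [aux_sinr M τ P (β k) (u k) _ d Y (hβ k) hP hS (hu k) hD', hD]

lemma aux_le {K : Type*} [Fintype K] [Nonempty K] (M τ P d Y : ℝ) (hM : 0 < M) (hτ : 0 < τ)
    (hP : 0 < P) (hd : 0 ≤ d)
    (β u : K → ℝ) (hβ : ∀ k, 0 < β k) (hu0 : ∀ k, 0 ≤ u k)
    (hY : ∃ k, u k * β k ^ 2 / (1 + P * β k) ≤ Y) :
    ∃ k, M * (τ * u k * β k ^ 2 / (1 + τ * ∑ m, u m * β m)) * d /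
      (1 + (β k - τ * u k * β k ^ 2 / (1 + τ * ∑ m, u m * β m)) * P)
      ≤ M * d * (τ * Y / (1 + τ * (Y * (∑ m, (P + 1 / β m) - P)))) := by
  have hC := aux_C P hP β hβ
  set C := ∑ m, (P + 1 / β m) - P with hCdef
  set x : K → ℝ := fun k => u k * β k ^ 2 / (1 + P * β k) with hx
  have h1 : ∀ k, 0 < 1 + P * β k := fun k => by have := hβ k; positivity
  have hxe : ∀ k, u k * β k ^ 2 = x k * (1 + P * β k) := fun k => by
    have := (h1 k).ne'
    simp only [hx]; rw [div_mul_cancel₀ _ this]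
  have hx0 : ∀ k, 0 ≤ x k := fun k => by
    have := h1 k; have := hu0 k
    simp only [hx]; positivity
  obtain ⟨k0, hk0⟩ := Finite.exists_min x
  obtain ⟨k1, hk1⟩ := hY
  have hle : x k0 ≤ Y := (hk0 k1).trans hk1
  have hY0 : 0 ≤ Y := (hx0 k0).trans hle
  have hs : x k0 * ∑ m, (P + 1 / β m) ≤ ∑ m, u m * β m := by
    rw [aux_sum P β u x hβ hxe, Finset.mul_sum]
    refine Finset.sum_le_sum fun m _ => ?_
    have := hβ m
    exact mul_le_mul_of_nonneg_right (hk0 m) (by positivity)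
  have hD : 1 + τ * (x k0 * C) ≤ 1 + τ * ∑ m, u m * β m - τ * P * x k0 := by
    have := mul_le_mul_of_nonneg_left hs hτ.le
    have e : τ * (x k0 * C) = τ * (x k0 * ∑ m, (P + 1 / β m)) - τ * P * x k0 := by
      rw [hCdef]; ring
    linarith
  have hx00 := hx0 k0
  have hpos : 0 < 1 + τ * (x k0 * C) := by positivity
  have hposY : 0 < 1 + τ * (Y * C) := by positivity
  have hD' := hpos.trans_le hD
  have hS : 0 < 1 + τ * ∑ m, u m * β m := by
    have : 0 ≤ τ * P * x k0 := by positivity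
    linarith
  refine ⟨k0, ?_⟩
  rw [aux_sinr M τ P (β k0) (u k0) _ d (x k0) (hβ k0) hP hS (hxe k0) hD']
  refine mul_le_mul_of_nonneg_left ?_ (by positivity)
  calc _ ≤ τ * x k0 / (1 + τ * (x k0 * C)) := by
        exact div_le_div_of_nonneg_left (by positivity) hpos hD
    _ ≤ _ := by
        rw [div_le_div_iff₀ hpos hposY]
        nlinarith [mul_le_mul_of_nonneg_left hle hτ.le]

/-- Theorem 8 (max–min fairness for zero-forcing multicast with co-pilot
assignment): with array gain `M = N − G > 0`, co-pilot estimation quality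
`γcp(u,i,k) = τ·u(i,k)·β(i,k)² / (1 + τ·∑_m u(i,m)·β(i,m))` and per-group
downlink powers `d`, the greatest achievable minimum SINR equals
`Γ = P·M / ∑ 1/Δ i`, attained at `u = u*` and `d i = P/(Δ i · ∑_j 1/Δ j)`,
where all users' SINRs equal `Γ`. -/
theorem stmt_7 {G : Type*} [Fintype G] [Nonempty G]
    (K : G → Type*) [∀ i, Fintype (K i)] [∀ i, Nonempty (K i)]
    (M τ P : ℝ) (hM : 0 < M) (hτ : 0 < τ) (hP : 0 < P)
    (β ptot : ∀ i, K i → ℝ) (hβ : ∀ i k, 0 < β i k) (hptot : ∀ i k, 0 < ptot i k) :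
    haveI : Nonempty ((i : G) × K i) :=
      ⟨⟨Classical.arbitrary G, Classical.arbitrary _⟩⟩
    let γcp : (∀ i, K i → ℝ) → ∀ i, K i → ℝ := fun u i k =>
      τ * u i k * β i k ^ 2 / (1 + τ * ∑ m, u i m * β i m)
    let sinr : (∀ i, K i → ℝ) → (G → ℝ) → ∀ i, K i → ℝ := fun u d i k =>
      M * γcp u i k * d i / (1 + (β i k - γcp u i k) * P)
    let mmin : (∀ i, K i → ℝ) → (G → ℝ) → ℝ := fun u d =>
      univ.inf' univ_nonempty (fun s : Σ i, K i => sinr u d s.1 s.2)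
    let Υ : G → ℝ := fun i =>
      univ.inf' univ_nonempty (fun k : K i => ptot i k * β i k ^ 2 / (1 + P * β i k))
    let us : ∀ i, K i → ℝ := fun i k => (1 + P * β i k) * Υ i / β i k ^ 2
    let E : G → ℝ := fun i =>
      (Fintype.card (K i) : ℝ) * Υ i * P + Υ i * ∑ m, 1 / β i m
    let Δ : G → ℝ := fun i => τ * Υ i / (1 + τ * (E i - P * Υ i))
    let Γ : ℝ := P * M / ∑ i, 1 / Δ i
    let ds : G → ℝ := fun i => P / (Δ i * ∑ j, 1 / Δ j)
    IsGreatest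
      {v : ℝ | ∃ (u : ∀ i, K i → ℝ) (d : G → ℝ),
        (∀ i k, 0 ≤ u i k ∧ u i k ≤ ptot i k) ∧ (∀ i, 0 ≤ d i) ∧
        (∑ i, d i) = P ∧ v = mmin u d} Γ ∧
    (∀ i k, 0 ≤ us i k ∧ us i k ≤ ptot i k) ∧ (∀ i, 0 ≤ ds i) ∧
    (∑ i, ds i) = P ∧ mmin us ds = Γ ∧
    ∀ i k, sinr us ds i k = Γ := by
  intro γcp sinr mmin Υ us E Δ Γ ds
  have h1 : ∀ i k, 0 < 1 + P * β i k := fun i k => by have := hβ i k; positivity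
  have hΥ : ∀ i, 0 < Υ i := fun i => by
    simp only [Υ]
    rw [Finset.lt_inf'_iff]
    intro k _
    have := hβ i k; have := hptot i k; have := h1 i k
    positivity
  have hΥle : ∀ i k, Υ i ≤ ptot i k * β i k ^ 2 / (1 + P * β i k) := fun i k =>
    Finset.inf'_le _ (Finset.mem_univ k)
  have hΔeq : ∀ i, Δ i = τ * Υ i / (1 + τ * (Υ i * (∑ m, (P + 1 / β i m) - P))) := fun i => by
    have : E i - P * Υ i = Υ i * (∑ m, (P + 1 / β i m) - P) := by
      simp only [E, Finset.sum_add_distrib, Finset.sum_const, Finset.card_univ, nsmul_eq_mul]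
      ring
    simp only [Δ]
    rw [this]
  have hΔ : ∀ i, 0 < Δ i := fun i => by
    rw [hΔeq]
    have := aux_C P hP (β i) (hβ i)
    have := hΥ i
    positivity
  have hT : 0 < ∑ j, 1 / Δ j :=
    Finset.sum_pos (fun j _ => one_div_pos.mpr (hΔ j)) Finset.univ_nonempty
  have husx : ∀ i k, us i k * β i k ^ 2 = Υ i * (1 + P * β i k) := fun i k => by
    have := (hβ i k).ne'
    simp only [us]; field_simp
  have husf : ∀ i k, 0 ≤ us i k ∧ us i k ≤ ptot i k := fun i k => by
    have hb := hβ i k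
    have h2 := h1 i k
    have h3 := hΥ i
    refine ⟨by simp only [us]; positivity, ?_⟩
    have h4 := (le_div_iff₀ h2).mp (hΥle i k)
    rw [← husx] at h4
    exact le_of_mul_le_mul_right h4 (by positivity)
  have hds0 : ∀ i, 0 ≤ ds i := fun i => by
    have := hΔ i
    simp only [ds]; positivity
  have hdsum : ∑ i, ds i = P := by
    have : ∀ i, ds i = P / (∑ j, 1 / Δ j) * (1 / Δ i) := fun i => by
      have := (hΔ i).ne'
      simp only [ds]; rw [div_mul_div_comm, mul_one, mul_comm (Δ i)]
    rw [Finset.sum_congr rfl fun i _ => this i, ← Finset.mul_sum, div_mul_cancel₀ _ hT.ne']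
  have hsinr : ∀ i k, sinr us ds i k = Γ := fun i k => by
    have h := aux_us M τ P (ds i) (Υ i) hτ hP (hΥ i) (β i) (us i) (hβ i) (husx i) k
    rw [← hΔeq] at h
    refine h.trans ?_
    have := (hΔ i).ne'
    have := hT.ne'
    simp only [ds, Γ]
    generalize ∑ j, 1 / Δ j = T at *
    field_simp
  have hmm : mmin us ds = Γ := by
    simp only [mmin, hsinr]
    exact Finset.inf'_const _ _
  refine ⟨⟨⟨us, ds, husf, hds0, hdsum, hmm.symm⟩, ?_⟩, husf, hds0, hdsum, hmm, hsinr⟩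
  rintro v ⟨u, d, hu, hd, hsum, rfl⟩
  have key : ∀ i, mmin u d * (1 / Δ i) ≤ M * d i := fun i => by
    have hex : ∃ k, u i k * β i k ^ 2 / (1 + P * β i k) ≤ Υ i := by
      obtain ⟨k, -, hk⟩ := Finset.exists_mem_eq_inf' (s := (univ : Finset (K i)))
        Finset.univ_nonempty (fun k : K i => ptot i k * β i k ^ 2 / (1 + P * β i k))
      refine ⟨k, ?_⟩
      have h2 := h1 i k
      have h3 := (hu i k).2
      have : Υ i = ptot i k * β i k ^ 2 / (1 + P * β i k) := hk
      rw [this]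
      gcongr
    obtain ⟨k, hk⟩ := aux_le M τ P (d i) (Υ i) hM hτ hP (hd i) (β i) (u i) (hβ i)
      (fun k => (hu i k).1) hex
    rw [← hΔeq] at hk
    have h5 : mmin u d ≤ sinr u d i k :=
      Finset.inf'_le (fun s : Σ i, K i => sinr u d s.1 s.2) (Finset.mem_univ (⟨i, k⟩ : Σ i, K i))
    rw [mul_one_div, div_le_iff₀ (hΔ i)]
    exact h5.trans hk
  have h6 := Finset.sum_le_sum fun i (_ : i ∈ univ) => key i
  rw [← Finset.mul_sum, ← Finset.mul_sum, hsum] at h6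
  simp only [Γ]
  rw [le_div_iff₀ hT]
  linarith
end

section
/- Let K be a nonempty finite index set, τ > 0 and P ≥ 0 reals, and β, t : K → ℝ with β k > 0 and t k > 0 for all k. For u : K → ℝ with 0 ≤ u k ≤ t k for all k, define φ(u) = min_{k ∈ K} [ τ·(u k)·(β k)² / (1 + τ·∑_{m ∈ K} (u m)·(β m)) ] / (1 + (β k)·P). Define Υ = min_{k} (t k)·(β k)²/(1 + (β k)·P) and u* k = (1 + (β k)·P)·Υ/(β k)². Then the maximum of φ over the box {u : 0 ≤ u k ≤ t k} is attained at u = u*, and the maximal value equals τ·Υ / (1 + τ·∑_{m} (u* m)·(β m)); moreover at u = u* the quantities (u* k)·(β k)²/(1 + (β k)·P) are equal to Υ for all k. -/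
open Finset

/-- Within-group uplink power equalization of Appendix E (proof of Theorem 7):
for a single multicast group under co-pilot training, the minimum over the group
of `γcp_k/(1 + β k·P)`, with `γcp_k = τ·u k·β k²/(1 + τ·∑_m u m·β m)`, is
maximized over the box `0 ≤ u k ≤ t k` at `u* k = (1 + β k·P)·Υ/β k²`, with
maximal value `τ·Υ/(1 + τ·∑_m u* m·β m)`; at `u*` the quantities
`u* k·β k²/(1 + β k·P)` all equal `Υ`. -/
theorem stmt_8 {K : Type*} [Fintype K] [Nonempty K]
    (τ P : ℝ) (hτ : 0 < τ) (hP : 0 ≤ P)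
    (β t : K → ℝ) (hβ : ∀ k, 0 < β k) (ht : ∀ k, 0 < t k) :
    let φ : (K → ℝ) → ℝ := fun u =>
      univ.inf' univ_nonempty (fun k =>
        (τ * u k * β k ^ 2 / (1 + τ * ∑ m, u m * β m)) / (1 + β k * P))
    let Υ : ℝ := univ.inf' univ_nonempty (fun k => t k * β k ^ 2 / (1 + β k * P))
    let us : K → ℝ := fun k => (1 + β k * P) * Υ / β k ^ 2
    (∀ k, 0 ≤ us k ∧ us k ≤ t k) ∧
    (∀ u : K → ℝ, (∀ k, 0 ≤ u k ∧ u k ≤ t k) → φ u ≤ φ us) ∧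
    φ us = τ * Υ / (1 + τ * ∑ m, us m * β m) ∧
    ∀ k, us k * β k ^ 2 / (1 + β k * P) = Υ := by
  intro φ Υ us
  have hd : ∀ k, 0 < 1 + β k * P := fun k => by
    have := mul_nonneg (hβ k).le hP
    linarith
  have hΥ : 0 < Υ := by
    refine (Finset.lt_inf'_iff _).2 fun k _ => ?_
    have := hd k
    have := hβ k
    have := ht k
    positivity
  have hΥle : ∀ k, Υ ≤ t k * β k ^ 2 / (1 + β k * P) := fun k =>
    Finset.inf'_le _ (mem_univ k)
  have heq : ∀ k, us k * β k ^ 2 / (1 + β k * P) = Υ := fun k => by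
    have h1 := (hd k).ne'
    have h2 := (hβ k).ne'
    show (1 + β k * P) * Υ / β k ^ 2 * β k ^ 2 / (1 + β k * P) = Υ
    rw [div_mul_cancel₀ _ (pow_ne_zero 2 h2), mul_div_cancel_left₀ _ h1]
  have hφ : φ us = τ * Υ / (1 + τ * ∑ m, us m * β m) := by
    have hc : ∀ k, (τ * us k * β k ^ 2 / (1 + τ * ∑ m, us m * β m)) / (1 + β k * P)
        = τ * Υ / (1 + τ * ∑ m, us m * β m) := fun k => by
      rw [div_right_comm, mul_assoc, mul_div_assoc τ, heq k]
    show univ.inf' univ_nonempty (fun k =>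
        (τ * us k * β k ^ 2 / (1 + τ * ∑ m, us m * β m)) / (1 + β k * P)) = _
    simp only [hc]
    exact Finset.inf'_const _ _
  refine ⟨fun k => ⟨?_, ?_⟩, ?_, hφ, heq⟩
  · exact div_nonneg (mul_nonneg (hd k).le hΥ.le) (sq_nonneg _)
  · show (1 + β k * P) * Υ / β k ^ 2 ≤ t k
    rw [div_le_iff₀ (pow_pos (hβ k) 2)]
    have := (le_div_iff₀ (hd k)).1 (hΥle k)
    linarith
  · intro u hu
    obtain ⟨k0, -, hk0⟩ := Finset.exists_min_image univ
      (fun k => u k * β k ^ 2 / (1 + β k * P)) univ_nonempty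
    obtain ⟨v, hv⟩ : ∃ v, v = u k0 * β k0 ^ 2 / (1 + β k0 * P) := ⟨_, rfl⟩
    have hv0 : 0 ≤ v := by
      rw [hv]
      exact div_nonneg (mul_nonneg (hu k0).1 (sq_nonneg _)) (hd k0).le
    have hvΥ : v ≤ Υ := by
      refine Finset.le_inf' _ _ fun k _ => ?_
      rw [hv]
      refine (hk0 k (mem_univ k)).trans ?_
      have := (hu k).2
      have := hd k
      gcongr
    set C : ℝ := ∑ m, (1 + β m * P) / β m with hC
    have hC0 : 0 ≤ C := Finset.sum_nonneg fun m _ => div_nonneg (hd m).le (hβ m).le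
    have hS : ∑ m, us m * β m = Υ * C := by
      rw [hC, Finset.mul_sum]
      refine Finset.sum_congr rfl fun m _ => ?_
      have h2 := (hβ m).ne'
      show (1 + β m * P) * Υ / β m ^ 2 * β m = _
      field_simp
    have hSu : v * C ≤ ∑ m, u m * β m := by
      rw [hC, Finset.mul_sum]
      refine Finset.sum_le_sum fun m _ => ?_
      have h := hk0 m (mem_univ m)
      simp only [← hv] at h
      rw [le_div_iff₀ (hd m)] at h
      rw [← mul_div_assoc, div_le_iff₀ (hβ m)]
      linarith
    have hvC := mul_nonneg hv0 hC0
    have hΥC := mul_nonneg hΥ.le hC0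
    have hp1 : 0 < 1 + τ * (v * C) := by positivity
    have hp2 : 0 < 1 + τ * (Υ * C) := by positivity
    have h1 : φ u ≤ τ * v / (1 + τ * ∑ m, u m * β m) := by
      have h := Finset.inf'_le (s := univ) (fun k =>
        (τ * u k * β k ^ 2 / (1 + τ * ∑ m, u m * β m)) / (1 + β k * P)) (mem_univ k0)
      refine h.trans (le_of_eq ?_)
      rw [div_right_comm, mul_assoc, mul_div_assoc τ, ← hv]
    have h2 : τ * v / (1 + τ * ∑ m, u m * β m) ≤ τ * v / (1 + τ * (v * C)) := by
      gcongr
    rw [hφ, hS]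
    refine h1.trans (h2.trans ?_)
    rw [div_le_div_iff₀ hp1 hp2]
    nlinarith [mul_le_mul_of_nonneg_left hvΥ hτ.le]
end

section
/- Let K be a nonempty finite index set, τ > 0 and P ≥ 0 reals, and β, t : K → ℝ with β k > 0 and t k > 0 for all k. For u : K → ℝ with 0 ≤ u k ≤ t k, define γ(u, k) = τ·(u k)·(β k)² / (1 + τ·∑_{m ∈ K} (u m)·(β m)) and ψ(u) = min_{k ∈ K} γ(u, k) / (1 + (β k − γ(u, k))·P). Define Υ = min_{k} (t k)·(β k)²/(1 + (β k)·P), u* k = (1 + (β k)·P)·Υ/(β k)², and E = |K|·Υ·P + Υ·∑_{m} 1/(β m). Then the maximum of ψ over the box {u : 0 ≤ u k ≤ t k} is attained at u = u*, and the maximal value equals τ·Υ/(1 + τ·(E − P·Υ)); moreover at u = u* the quantity γ(u*, k)/(1 + (β k − γ(u*, k))·P) is the same for every k ∈ K. -/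
open Finset

/-- The ratio in terms of the normalized power `x`. -/
lemma ratio_aux (τ P b v S x : ℝ) (hP : 0 ≤ P) (hb : 0 < b) (hS : 0 < S)
    (hx : v * b ^ 2 = x * (1 + b * P)) (hd : 0 < S - τ * x * P) :
    τ * v * b ^ 2 / S / (1 + (b - τ * v * b ^ 2 / S) * P) = τ * x / (S - τ * x * P) := by
  have h1 : 0 < 1 + b * P := by positivity
  have e1 : τ * v * b ^ 2 / S = τ * x * (1 + b * P) / S := by rw [mul_assoc, hx]; ring
  have e2 : 1 + (b - τ * x * (1 + b * P) / S) * P = (1 + b * P) * (S - τ * x * P) / S := by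
    field_simp
    ring
  rw [e1, e2]
  field_simp

/-- `x / (1 + x c)` is monotone. -/
lemma mono_aux (τ x y c : ℝ) (hτ : 0 < τ) (hx : 0 ≤ x) (hxy : x ≤ y) (hc : 0 ≤ c) :
    τ * x / (1 + τ * x * c) ≤ τ * y / (1 + τ * y * c) := by
  have hy : 0 ≤ y := hx.trans hxy
  rw [div_le_div_iff₀ (by positivity) (by positivity)]
  nlinarith [mul_le_mul_of_nonneg_left hxy hτ.le]

/-- Within-group uplink power equalization of Appendix F (proof of Theorem 8):
for a single multicast group under co-pilot training with zero-forcing downlink,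
the minimum over the group of `γ(u,k)/(1 + (β k − γ(u,k))·P)`, with
`γ(u,k) = τ·u k·β k²/(1 + τ·∑_m u m·β m)`, is maximized over the box
`0 ≤ u k ≤ t k` at `u* k = (1 + β k·P)·Υ/β k²`, with maximal value
`τ·Υ/(1 + τ·(E − P·Υ))`; at `u*` the ratio is the same for every `k`. -/
theorem stmt_9 {K : Type*} [Fintype K] [Nonempty K]
    (τ P : ℝ) (hτ : 0 < τ) (hP : 0 ≤ P)
    (β t : K → ℝ) (hβ : ∀ k, 0 < β k) (ht : ∀ k, 0 < t k) :
    let γ : (K → ℝ) → K → ℝ := fun u k =>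
      τ * u k * β k ^ 2 / (1 + τ * ∑ m, u m * β m)
    let ψ : (K → ℝ) → ℝ := fun u =>
      univ.inf' univ_nonempty (fun k => γ u k / (1 + (β k - γ u k) * P))
    let Υ : ℝ := univ.inf' univ_nonempty (fun k => t k * β k ^ 2 / (1 + β k * P))
    let us : K → ℝ := fun k => (1 + β k * P) * Υ / β k ^ 2
    let E : ℝ := (Fintype.card K : ℝ) * Υ * P + Υ * ∑ m, 1 / β m
    (∀ k, 0 ≤ us k ∧ us k ≤ t k) ∧
    (∀ u : K → ℝ, (∀ k, 0 ≤ u k ∧ u k ≤ t k) → ψ u ≤ ψ us) ∧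
    ψ us = τ * Υ / (1 + τ * (E - P * Υ)) ∧
    ∀ k l : K, γ us k / (1 + (β k - γ us k) * P) = γ us l / (1 + (β l - γ us l) * P) := by
  intro γ ψ Υ us E
  have hq : ∀ k, 0 < 1 + β k * P := fun k => by have := hβ k; positivity
  set C : ℝ := ∑ m, (1 / β m + P) with hC
  have hw : ∀ k, 0 ≤ 1 / β k + P := fun k => by have := hβ k; positivity
  have hCP : 0 ≤ C - P := by
    obtain ⟨k⟩ := ‹Nonempty K›
    have h1 : 1 / β k + P ≤ C :=
      Finset.single_le_sum (f := fun m => 1 / β m + P) (fun m _ => hw m) (mem_univ k)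
    have h2 : 0 < 1 / β k := by have := hβ k; positivity
    linarith
  have hΥ : 0 < Υ := by
    refine (Finset.lt_inf'_iff _).2 fun k _ => ?_
    have := hβ k; have := ht k; have := hq k; positivity
  have hΥle : ∀ k, Υ ≤ t k * β k ^ 2 / (1 + β k * P) := fun k =>
    Finset.inf'_le (fun k => t k * β k ^ 2 / (1 + β k * P)) (mem_univ k)
  have hE : E = Υ * C := by
    simp only [E, hC, Finset.sum_add_distrib, Finset.sum_const, Finset.card_univ, nsmul_eq_mul]
    ring
  have husx : ∀ k, us k * β k ^ 2 = Υ * (1 + β k * P) := fun k => by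
    have := (hβ k).ne'
    simp only [us]; field_simp
  have hsum : ∑ m, us m * β m = Υ * C := by
    rw [hC, Finset.mul_sum]
    refine Finset.sum_congr rfl fun k _ => ?_
    have := (hβ k).ne'
    simp only [us]; field_simp
  have hrat : ∀ k, γ us k / (1 + (β k - γ us k) * P) = τ * Υ / (1 + τ * Υ * (C - P)) := by
    intro k
    have hpos : 0 ≤ τ * Υ * (C - P) := by positivity
    have hpos' : 0 ≤ τ * Υ * P := by positivity
    have := ratio_aux τ P (β k) (us k) (1 + τ * ∑ m, us m * β m) Υ hP (hβ k)
      (by rw [hsum]; linarith) (husx k) (by rw [hsum]; linarith)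
    refine this.trans ?_
    rw [hsum]; congr 1; ring
  have hψ : ψ us = τ * Υ / (1 + τ * Υ * (C - P)) := by
    simp only [ψ]
    simp only [hrat]
    exact Finset.inf'_const _ _
  refine ⟨fun k => ⟨?_, ?_⟩, fun u hu => ?_, ?_, fun k l => by rw [hrat, hrat]⟩
  · have := hβ k; have := hq k
    simp only [us]; positivity
  · have h := hΥle k
    have hb := hβ k
    rw [le_div_iff₀ (hq k)] at h
    simp only [us]
    rw [div_le_iff₀ (by positivity)]
    linarith
  · rw [hψ]
    obtain ⟨x, hx⟩ : ∃ x : K → ℝ, x = fun k => u k * β k ^ 2 / (1 + β k * P) := ⟨_, rfl⟩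
    obtain ⟨k, -, hk⟩ := Finset.exists_min_image univ x univ_nonempty
    have hxe : ∀ m, u m * β m ^ 2 = x m * (1 + β m * P) := fun m => by
      have := (hq m).ne'
      simp only [hx]; field_simp
    have hx0 : 0 ≤ x k := by
      have := (hu k).1; have := hq k
      simp only [hx]; positivity
    have hxΥ : x k ≤ Υ := by
      refine Finset.le_inf' _ _ fun m _ => (hk m (mem_univ m)).trans ?_
      have := (hu m).2; have := hq m
      simp only [hx]; gcongr
    have hS : x k * C ≤ ∑ m, u m * β m := by
      rw [hC, Finset.mul_sum]
      refine Finset.sum_le_sum fun m _ => ?_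
      have h1 : u m * β m = x m * (1 / β m + P) := by
        have hb := (hβ m).ne'
        have := hxe m
        field_simp
        linarith
      rw [h1]
      exact mul_le_mul_of_nonneg_right (hk m (mem_univ m)) (hw m)
    have hS' : τ * (x k * C) ≤ τ * ∑ m, u m * β m := mul_le_mul_of_nonneg_left hS hτ.le
    have hpos : 0 ≤ τ * x k * (C - P) := by positivity
    have hpos' : 0 ≤ τ * x k * P := by positivity
    have hr := ratio_aux τ P (β k) (u k) (1 + τ * ∑ m, u m * β m) (x k) hP (hβ k)
      (by linarith) (hxe k) (by linarith)
    calc ψ u ≤ γ u k / (1 + (β k - γ u k) * P) :=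
          Finset.inf'_le (fun k => γ u k / (1 + (β k - γ u k) * P)) (mem_univ k)
      _ = τ * x k / (1 + τ * ∑ m, u m * β m - τ * x k * P) := hr
      _ ≤ τ * x k / (1 + τ * x k * (C - P)) := by
          apply div_le_div_of_nonneg_left (by positivity) (by linarith) (by linarith)
      _ ≤ _ := mono_aux τ (x k) Υ (C - P) hτ hx0 hxΥ hCP
  · rw [hψ, hE]; congr 1; ring
end
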